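/- Let k ≥ 1 and n ≥ 2 be integers with gcd(n, k) ≠ 1. Then n²·L(e^{2/k}, 1/n) = 1/2 and n²·L(e^{2/k}, −e^{2/k}/n) = 1/2. -/

import Mathlib

/-- Distance from a real number to the nearest integer. -/
noncomputable def distNearestInt (x : ℝ) : ℝ := |x - round x|

/-- The inhomogeneous approximation constant. -/
noncomputable def Lconst (θ φ : ℝ) : ℝ :=
  Filter.liminf (fun q : ℤ => |(q : ℝ)| * distNearestInt (q * θ - φ)) Filter.cofinite

open Filter

/-- The solution with initial values `a`, `b` of the three-term recurrence
`x (m + 2) = (2 * m + 1) * k * x (m + 1) + x m` satisfied by the numerators and denominators of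
the rescaled diagonal Padé approximants to `exp` at `2 / k`. -/
def padeSeq (k a b : ℤ) : ℕ → ℤ
  | 0 => a
  | 1 => b
  | m + 2 => (2 * m + 1) * k * padeSeq k a b (m + 1) + padeSeq k a b m

/-- Numerators of the rescaled diagonal Padé approximants to `exp` at `2 / k`. -/
def padeNum (k : ℤ) : ℕ → ℤ := padeSeq k 1 1

/-- Denominators of the rescaled diagonal Padé approximants to `exp` at `2 / k`. -/
def padeDen (k : ℤ) : ℕ → ℤ := padeSeq k (-1) 1

lemma padeNum_add_two (k : ℤ) (m : ℕ) :
    padeNum k (m + 2) = (2 * m + 1) * k * padeNum k (m + 1) + padeNum k m := rfl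

lemma padeDen_add_two (k : ℤ) (m : ℕ) :
    padeDen k (m + 2) = (2 * m + 1) * k * padeDen k (m + 1) + padeDen k m := rfl

lemma padeDen_mul_padeNum_sub (k : ℤ) (m : ℕ) :
    padeDen k m * padeNum k (m + 1) - padeDen k (m + 1) * padeNum k m = 2 * (-1) ^ (m + 1) := by
  induction m with
  | zero => rfl
  | succ m ih =>
    rw [padeNum_add_two, padeDen_add_two, pow_succ]
    linear_combination -ih

lemma padeDen_growth {k : ℤ} (hk : 2 ≤ k) (m : ℕ) :
    1 ≤ padeDen k (m + 1) ∧ (m + 1) * padeDen k (m + 1) ≤ padeDen k (m + 2) := by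
  induction m with
  | zero =>
    have h0 : padeDen k 0 = -1 := rfl
    have h1 : padeDen k 1 = 1 := rfl
    have h2 := padeDen_add_two k 0
    simp only [zero_add, h0, h1] at h2 ⊢
    push_cast at h2
    refine ⟨le_rfl, ?_⟩
    push_cast
    linarith
  | succ m ih =>
    obtain ⟨h1, h2⟩ := ih
    have h3 := padeDen_add_two k (m + 1)
    have h4 : 1 ≤ padeDen k (m + 2) := by nlinarith
    refine ⟨h4, ?_⟩
    change ((m + 1 : ℕ) + 1 : ℤ) * padeDen k (m + 2) ≤ padeDen k (m + 1 + 2)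
    rw [h3]
    change _ ≤ _ * padeDen k (m + 2) + _
    have h5 : ((m + 1 : ℕ) + 1 : ℤ) ≤ (2 * (m + 1 : ℕ) + 1) * k := by
      push_cast
      nlinarith
    nlinarith [mul_le_mul_of_nonneg_right h5 (by linarith : 0 ≤ padeDen k (m + 2))]

lemma padeSeq_modEq_of_dvd {g k : ℤ} (hg : g ∣ k) (a b : ℤ) (m : ℕ) :
    padeSeq k a b m ≡ (if Even m then a else b) [ZMOD g] := by
  induction m using Nat.twoStepInduction with
  | zero => rfl
  | one => rfl
  | more m ih _ =>
    have h : padeSeq k a b (m + 2) ≡ padeSeq k a b m [ZMOD g] := by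
      refine (Int.modEq_iff_dvd.2 ?_).symm
      have : padeSeq k a b (m + 2) - padeSeq k a b m
          = k * ((2 * m + 1) * padeSeq k a b (m + 1)) := by
        rw [padeSeq]; ring
      exact this ▸ hg.mul_right _
    simpa [Nat.even_add] using h.trans ih

lemma padeSeq_modEq_shift_iff (k a b : ℤ) {n L : ℤ} {l : ℕ} (hL : (l : ℤ) = n * L) (i : ℕ) :
    (padeSeq k a b (i + l) ≡ padeSeq k a b i [ZMOD n] ∧
      padeSeq k a b (i + 1 + l) ≡ padeSeq k a b (i + 1) [ZMOD n]) ↔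
    (padeSeq k a b l ≡ a [ZMOD n] ∧ padeSeq k a b (1 + l) ≡ b [ZMOD n]) := by
  induction i with
  | zero => simp [padeSeq]
  | succ i ih =>
    rw [← ih]
    have h1 : padeSeq k a b (i + 1 + 1 + l)
        = (2 * (i + l : ℕ) + 1) * k * padeSeq k a b (i + 1 + l) + padeSeq k a b (i + l) := by
      rw [show i + 1 + 1 + l = (i + l) + 2 by ring, padeSeq,
        show i + l + 1 = i + 1 + l by ring]
    have h2 : padeSeq k a b (i + 1 + 1)
        = (2 * i + 1) * k * padeSeq k a b (i + 1) + padeSeq k a b i := rfl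
    have h3 : (2 * (i + l : ℕ) + 1 : ℤ) * k ≡ (2 * i + 1) * k [ZMOD n] := by
      refine (Int.modEq_iff_dvd.2 ⟨2 * L * k, ?_⟩).symm
      push_cast
      rw [hL]; ring
    rw [h1, h2]
    constructor
    · rintro ⟨h4, h5⟩
      exact ⟨Int.ModEq.add_left_cancel (h3.mul h4) h5, h4⟩
    · rintro ⟨h4, h5⟩
      exact ⟨h5, (h3.mul h5).add h4⟩

lemma exists_padeSeq_modEq_initial (k : ℤ) {n : ℕ} (hn : 0 < n) (N : ℕ) :
    ∃ m, N ≤ m ∧ padeNum k m ≡ 1 [ZMOD n] ∧ padeNum k (m + 1) ≡ 1 [ZMOD n] ∧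
      padeDen k m ≡ -1 [ZMOD n] ∧ padeDen k (m + 1) ≡ 1 [ZMOD n] := by
  have : NeZero n := ⟨hn.ne'⟩
  let S : ℕ → ZMod n × ZMod n × ZMod n × ZMod n := fun t =>
    ((padeNum k (n * (N + 1) * t) : ZMod n), (padeNum k (n * (N + 1) * t + 1) : ZMod n),
      (padeDen k (n * (N + 1) * t) : ZMod n), (padeDen k (n * (N + 1) * t + 1) : ZMod n))
  obtain ⟨a, b, hab, hS⟩ : ∃ a b, a < b ∧ S a = S b := by
    obtain ⟨a, b, hne, h⟩ := Finite.exists_ne_map_eq_of_infinite S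
    rcases hne.lt_or_gt with h' | h'
    · exact ⟨a, b, h', h⟩
    · exact ⟨b, a, h', h.symm⟩
  obtain ⟨d, rfl⟩ := Nat.exists_eq_add_of_lt hab
  simp only [S, Prod.mk.injEq, ZMod.intCast_eq_intCast_iff] at hS
  obtain ⟨h1, h2, h3, h4⟩ := hS
  have hl : ((n * (N + 1) * (d + 1) : ℕ) : ℤ) = (n : ℤ) * ((N + 1) * (d + 1)) := by
    push_cast; ring
  have e1 : n * (N + 1) * (a + d + 1) = n * (N + 1) * a + n * (N + 1) * (d + 1) := by ring
  have e2 : n * (N + 1) * (a + d + 1) + 1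
      = n * (N + 1) * a + 1 + n * (N + 1) * (d + 1) := by ring
  rw [e2] at h2 h4
  rw [e1] at h1 h3
  obtain ⟨h5, h6⟩ := (padeSeq_modEq_shift_iff k 1 1 hl _).1 ⟨h1.symm, h2.symm⟩
  obtain ⟨h7, h8⟩ := (padeSeq_modEq_shift_iff k (-1) 1 hl _).1 ⟨h3.symm, h4.symm⟩
  rw [add_comm] at h6 h8
  refine ⟨_, ?_, h5, h6, h7, h8⟩
  nlinarith [Nat.zero_le (n * N * d), Nat.zero_le (n * d), Nat.zero_le (n * N),
    Nat.mul_le_mul_right N hn]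

/-- The functions `t ^ (m + 1) * i_m t`, with `i_m` the modified spherical Bessel functions of the
first kind. -/
noncomputable def besselAux : ℕ → ℝ → ℝ
  | 0 => Real.sinh
  | 1 => fun t => t * Real.cosh t - Real.sinh t
  | m + 2 => fun t => t ^ 2 * besselAux m t - (2 * m + 3) * besselAux (m + 1) t

lemma hasDerivAt_besselAux_succ (m : ℕ) (t : ℝ) :
    HasDerivAt (besselAux (m + 1)) (t * besselAux m t) t := by
  induction m using Nat.twoStepInduction with
  | zero =>
    refine (((hasDerivAt_id t).mul (Real.hasDerivAt_cosh t)).sub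
      (Real.hasDerivAt_sinh t)).congr_deriv ?_
    simp [besselAux]
  | one =>
    refine (((hasDerivAt_pow 2 t).mul (Real.hasDerivAt_sinh t)).sub
      ((((hasDerivAt_id t).mul (Real.hasDerivAt_cosh t)).sub
        (Real.hasDerivAt_sinh t)).const_mul (2 * (0 : ℕ) + 3 : ℝ))).congr_deriv ?_
    simp [besselAux]
    ring
  | more m ih1 ih2 =>
    refine (((hasDerivAt_pow 2 t).mul ih1).sub
      (ih2.const_mul (2 * (m + 1 : ℕ) + 3 : ℝ))).congr_deriv ?_
    simp only [besselAux]
    push_cast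
    ring

lemma besselAux_zero (m : ℕ) : besselAux m 0 = 0 := by
  induction m using Nat.twoStepInduction with
  | zero => simp [besselAux]
  | one => simp [besselAux]
  | more m ih1 ih2 => simp [besselAux, ih2]

lemma besselAux_pos (m : ℕ) {t : ℝ} (ht : 0 < t) : 0 < besselAux m t := by
  induction m generalizing t with
  | zero => exact Real.sinh_pos_iff.2 ht
  | succ m ih =>
    rw [← besselAux_zero (m + 1)]
    refine strictMonoOn_of_deriv_pos (convex_Ici 0)
      (fun x _ => (hasDerivAt_besselAux_succ m x).continuousAt.continuousWithinAt)
      (fun x hx => ?_) Set.self_mem_Ici ht.le ht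
    rw [interior_Ici] at hx
    rw [(hasDerivAt_besselAux_succ m x).deriv]
    exact mul_pos hx (ih hx)

/-- The error `q * exp (2 / k) - p` of the rescaled Padé approximant `p / q`. -/
noncomputable def padeErr (k : ℕ) (m : ℕ) : ℝ :=
  padeDen k m * Real.exp (2 / k) - padeNum k m

lemma padeErr_add_two (k m : ℕ) :
    padeErr k (m + 2) = (2 * m + 1) * k * padeErr k (m + 1) + padeErr k m := by
  simp only [padeErr, padeNum_add_two, padeDen_add_two]
  push_cast
  ring

lemma padeErr_succ_eq {k : ℕ} (hk : 1 ≤ k) (m : ℕ) :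
    padeErr k (m + 1)
      = (-1) ^ m * (2 * Real.exp (1 / k) * (k : ℝ) ^ m * besselAux m (1 / k)) := by
  have hk0 : (k : ℝ) ≠ 0 := by positivity
  have hexp : Real.exp (2 / k) = Real.exp (1 / k) * Real.exp (1 / k) := by
    rw [← Real.exp_add]; congr 1; ring
  have hexp' : Real.exp (1 / k) * Real.exp (-(1 / k)) = 1 := by
    rw [← Real.exp_add]; simp
  have h0 : padeErr k 0 = -Real.exp (2 / k) - 1 := by
    simp [padeErr, padeNum, padeDen, padeSeq]
  have h1 : padeErr k 1 = Real.exp (2 / k) - 1 := by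
    simp [padeErr, padeNum, padeDen, padeSeq]
  induction m using Nat.twoStepInduction with
  | zero =>
    rw [zero_add, h1, hexp]
    simp only [besselAux, Real.sinh_eq]
    linear_combination hexp'
  | one =>
    rw [padeErr_add_two, zero_add, h1, h0, hexp]
    simp only [besselAux, Real.sinh_eq, Real.cosh_eq]
    push_cast
    field_simp
    field_simp at hexp'
    linear_combination (k + 1) * hexp'
  | more m ih1 ih2 =>
    rw [padeErr_add_two, ih1, ih2]
    simp only [besselAux]
    push_cast
    field_simp
    ring

lemma padeErr_det (k m : ℕ) :
    padeDen k (m + 1) * padeErr k m - padeDen k m * padeErr k (m + 1) = 2 * (-1) ^ (m + 1) := by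
  have h := congrArg (Int.cast : ℤ → ℝ) (padeDen_mul_padeNum_sub k m)
  push_cast at h
  simp only [padeErr]
  linear_combination h

lemma padeErr_succ_ne_zero {k : ℕ} (hk : 1 ≤ k) (m : ℕ) : padeErr k (m + 1) ≠ 0 := by
  have hk0 : (0 : ℝ) < k := by exact_mod_cast hk
  have := besselAux_pos m (one_div_pos.2 hk0)
  rw [padeErr_succ_eq hk]
  positivity

lemma padeDen_mul_abs_padeErr_le {k : ℕ} (hk : 2 ≤ k) (m : ℕ) :
    padeDen k (m + 2) * |padeErr k (m + 1)| ≤ 2 := by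
  have hk0 : (0 : ℝ) < k := by positivity
  have hdet := padeErr_det k (m + 1)
  have h1 : (1 : ℝ) ≤ padeDen k (m + 1) := by
    exact_mod_cast (padeDen_growth (by exact_mod_cast hk) m).1
  rw [padeErr_succ_eq (by lia) m, padeErr_succ_eq (by lia) (m + 1)] at hdet
  rw [padeErr_succ_eq (by lia) m]
  have hA := besselAux_pos m (one_div_pos.2 hk0)
  have hB := besselAux_pos (m + 1) (one_div_pos.2 hk0)
  have hA' : 0 < 2 * Real.exp (1 / k) * (k : ℝ) ^ m * besselAux m (1 / k) := by positivity
  have hB' : 0 < 2 * Real.exp (1 / k) * (k : ℝ) ^ (m + 1) * besselAux (m + 1) (1 / k) := by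
    positivity
  set A := 2 * Real.exp (1 / k) * (k : ℝ) ^ m * besselAux m (1 / k)
  set B := 2 * Real.exp (1 / k) * (k : ℝ) ^ (m + 1) * besselAux (m + 1) (1 / k)
  rw [abs_mul, abs_pow, abs_neg, abs_one, one_pow, one_mul, abs_of_pos hA']
  have hs : ((-1 : ℝ) ^ m) * (-1) ^ m = 1 := by rw [← mul_pow]; simp
  have key : padeDen k (m + 2) * A + padeDen k (m + 1) * B = 2 := by
    rw [pow_succ, pow_succ] at hdet
    linear_combination (-1 : ℝ) ^ m * hdet +
      (2 - padeDen k (m + 2) * A - padeDen k (m + 1) * B) * hs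
  nlinarith

lemma padeDen_mul_padeErr_le {k : ℕ} (hk : 2 ≤ k) (m : ℕ) :
    (m + 1) * (padeDen k (m + 1) * |padeErr k (m + 1)|) ≤ 2 := by
  refine le_trans ?_ (padeDen_mul_abs_padeErr_le hk m)
  rw [← mul_assoc]
  refine mul_le_mul_of_nonneg_right ?_ (abs_nonneg _)
  exact_mod_cast (padeDen_growth (k := k) (by exact_mod_cast hk) m).2

lemma exists_padeDen_mul_padeErr_le {k : ℕ} (hk : 2 ≤ k) {ε : ℝ} (hε : 0 < ε) :
    ∃ M, ∀ m ≥ M, padeDen k (m + 1) * |padeErr k (m + 1)| ≤ ε := by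
  obtain ⟨M, hM⟩ := exists_nat_gt (2 / ε)
  refine ⟨M, fun m hm => ?_⟩
  have h := padeDen_mul_padeErr_le hk m
  have hm' : (M : ℝ) ≤ m := by exact_mod_cast hm
  rw [div_lt_iff₀ hε] at hM
  by_contra! hlt
  nlinarith

/-- If two consecutive approximants with denominators `q`, `q'` and errors `e`, `e'` have
determinant `±2`, then any third one, with denominator `R` and error `E`, that is a multiple of
neither satisfies an almost optimal lower bound. -/
lemma two_sub_le_of_det {q q' e e' R E s η : ℝ} (hq : 1 ≤ q) (hq' : q ≤ q')
    (hd1 : q * |e| ≤ η) (hd2 : q' * |e'| ≤ η) (hprod : q' * |e| ≤ 2) (hsabs : |s| = 1)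
    (hdet : q' * e - q * e' = 2 * s) (hx : 1 ≤ |q' * E - R * e'|) (hy : 1 ≤ |q * E - R * e|)
    (hRe1 : 1 / 4 ≤ |R| * |e|) (hRe' : |R| * |e'| < 1 / 4) (hQE : |R| * |E| ≤ 1 / 2) :
    2 - 121 * η ≤ 4 * (|R| * |E|) := by
  have hq'0 : 0 < q' := by linarith
  have hx' := abs_sub (q' * E) (R * e')
  have hy' := abs_sub (q * E) (R * e)
  rw [abs_mul, abs_mul R, abs_of_pos hq'0] at hx'
  rw [abs_mul, abs_mul R, abs_of_pos (by linarith : 0 < q)] at hy'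
  generalize hxdef : q' * E - R * e' = x at *
  generalize hydef : q * E - R * e = y at *
  have hR0 : 0 < |R| := by
    by_contra! h
    nlinarith [abs_nonneg e]
  have hq8 : q' ≤ 8 * |R| := by
    linarith [mul_le_mul_of_nonneg_left hRe1 hq'0.le, mul_le_mul_of_nonneg_left hprod hR0.le]
  have hq'E : q' * |E| ≤ 4 := by
    linarith [mul_le_mul_of_nonneg_right hq8 (abs_nonneg E)]
  have hR : 3 / 4 * |R| ≤ q' / 2 := by
    have h : 3 / 4 ≤ q' * |E| := by linarith
    linarith [mul_le_mul_of_nonneg_left h hR0.le, mul_le_mul_of_nonneg_left hQE hq'0.le]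
  have hRe : |R| * |e| ≤ 4 / 3 := by
    linarith [mul_le_mul_of_nonneg_right hR (abs_nonneg e)]
  have hx5 : |x| ≤ 5 := by linarith
  have hy6 : |y| ≤ 6 := by
    linarith [mul_le_mul_of_nonneg_right hq' (abs_nonneg E)]
  have hqe' : q * |e'| ≤ η := (mul_le_mul_of_nonneg_right hq' (abs_nonneg e')).trans hd2
  have hs : s ^ 2 = 1 := by rw [← sq_abs, hsabs, one_pow]
  have hid : 2 * s * (x * y)
      = x ^ 2 * (q * e) + y ^ 2 * (q' * e') - 2 * (x * y) * (q * e') - 4 * (R * E) := by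
    have h1 : x * e - y * e' = 2 * s * E := by
      rw [← hxdef, ← hydef]; linear_combination E * hdet
    have h2 : x * q - y * q' = 2 * s * R := by
      rw [← hxdef, ← hydef]; linear_combination R * hdet
    linear_combination -(x * q - y * q') * h1 - 2 * s * E * h2 - 4 * R * E * hs - x * y * hdet
  have hx2 : x ^ 2 ≤ 25 := by linarith [sq_le_sq' (by linarith [abs_nonneg x]) hx5, sq_abs x]
  have hy2 : y ^ 2 ≤ 36 := by linarith [sq_le_sq' (by linarith [abs_nonneg y]) hy6, sq_abs y]
  have hxy1 : 1 ≤ |x * y| := by rw [abs_mul]; exact one_le_mul_of_one_le_of_one_le hx hy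
  have hxy2 : |x * y| ≤ 30 := by 
    rw [abs_mul]; linarith [mul_le_mul hx5 hy6 (abs_nonneg y) (by norm_num)]
  have hlow : 2 ≤ |2 * s * (x * y)| := by
    rw [abs_mul, abs_mul, hsabs, abs_two]; linarith
  rw [hid] at hlow
  have t1 : |x ^ 2 * (q * e)| ≤ 25 * η := by
    rw [abs_mul, abs_mul, abs_of_nonneg (sq_nonneg x), abs_of_pos (by linarith : 0 < q)]
    exact mul_le_mul hx2 hd1 (by positivity) (by norm_num)
  have t2 : |y ^ 2 * (q' * e')| ≤ 36 * η := by
    rw [abs_mul, abs_mul, abs_of_nonneg (sq_nonneg y), abs_of_pos (by linarith : 0 < q')]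
    exact mul_le_mul hy2 hd2 (mul_nonneg (by linarith) (abs_nonneg _)) (by norm_num)
  have t3 : |2 * (x * y) * (q * e')| ≤ 60 * η := by
    rw [abs_mul, abs_mul, abs_mul q, abs_two, abs_of_pos (by linarith : 0 < q)]
    exact mul_le_mul (by linarith) hqe' (mul_nonneg (by linarith) (abs_nonneg _)) (by norm_num)
  have t4 : |4 * (R * E)| = 4 * (|R| * |E|) := by
    rw [abs_mul, abs_mul]; norm_num
  have u1 := abs_sub (x ^ 2 * (q * e) + y ^ 2 * (q' * e') - 2 * (x * y) * (q * e')) (4 * (R * E))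
  have u2 := abs_sub (x ^ 2 * (q * e) + y ^ 2 * (q' * e')) (2 * (x * y) * (q * e'))
  have u3 := abs_add_le (x ^ 2 * (q * e)) (y ^ 2 * (q' * e'))
  linarith

lemma half_sub_le_abs_mul_abs {k : ℕ} (hk : 2 ≤ k) {ε : ℝ} (hε : 0 < ε) :
    ∃ N : ℝ, ∀ P Q : ℤ, N ≤ |(Q : ℝ)| →
      (∀ m, P * padeDen k (m + 1) ≠ Q * padeNum k (m + 1)) →
      1 / 2 - ε ≤ |(Q : ℝ)| * |Q * Real.exp (2 / k) - P| := by
  obtain ⟨M, hM⟩ := exists_padeDen_mul_padeErr_le hk (by positivity : 0 < ε / 40)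
  have heM : 0 < |padeErr k (M + 1)| := abs_pos.2 (padeErr_succ_ne_zero (by lia) M)
  refine ⟨max 1 (1 / (4 * |padeErr k (M + 1)|)), fun P Q hQ hne => ?_⟩
  set E : ℝ := Q * Real.exp (2 / k) - P with hE
  by_contra! hlt
  have hQ1 : 1 ≤ |(Q : ℝ)| := (le_max_left _ _).trans hQ
  have hstart : 1 / 4 ≤ |(Q : ℝ)| * |padeErr k (M + 1)| := by
    have := (le_max_right _ _).trans hQ
    rw [div_le_iff₀ (by positivity)] at this
    linarith
  obtain ⟨m, hmM, hm1, hm2⟩ : ∃ m, M ≤ m ∧ 1 / 4 ≤ |(Q : ℝ)| * |padeErr k (m + 1)| ∧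
      |(Q : ℝ)| * |padeErr k (m + 2)| < 1 / 4 := by
    by_contra! hcon
    have hall : ∀ j, 1 / 4 ≤ |(Q : ℝ)| * |padeErr k (M + j + 1)| := by
      intro j
      induction j with
      | zero => exact hstart
      | succ j ih => exact hcon (M + j) (by lia) ih
    obtain ⟨M', hM'⟩ := exists_padeDen_mul_padeErr_le hk
      (by positivity : 0 < 1 / (8 * |(Q : ℝ)|))
    have h1 := hM' (M + M') (by lia)
    have h2 := hall M'
    have h3 : (1 : ℝ) ≤ padeDen k (M + M' + 1) := by
      exact_mod_cast (padeDen_growth (k := k) (by exact_mod_cast hk) _).1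
    rw [le_div_iff₀ (by positivity)] at h1
    nlinarith
  have hd1 := hM m hmM
  have hd2 := hM (m + 1) (by lia)
  have hprod := padeDen_mul_abs_padeErr_le hk m
  have hdet := padeErr_det k (m + 1)
  have hqge : (1 : ℝ) ≤ padeDen k (m + 1) := by
    exact_mod_cast (padeDen_growth (k := k) (by exact_mod_cast hk) _).1
  have hqmono : (padeDen k (m + 1) : ℝ) ≤ padeDen k (m + 2) := by
    have := padeDen_growth (k := k) (by exact_mod_cast hk) m
    have : padeDen k (m + 1) ≤ padeDen k (m + 2) := by nlinarith
    exact_mod_cast this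
  have hx : 1 ≤ |padeDen k (m + 2) * E - Q * padeErr k (m + 2)| := by
    have h : padeDen k (m + 2) * E - Q * padeErr k (m + 2)
        = ((Q * padeNum k (m + 2) - P * padeDen k (m + 2) : ℤ) : ℝ) := by
      simp only [hE, padeErr]; push_cast; ring
    rw [h]
    exact_mod_cast Int.one_le_abs (sub_ne_zero.2 (hne (m + 1)).symm)
  have hy : 1 ≤ |padeDen k (m + 1) * E - Q * padeErr k (m + 1)| := by
    have h : padeDen k (m + 1) * E - Q * padeErr k (m + 1)
        = ((Q * padeNum k (m + 1) - P * padeDen k (m + 1) : ℤ) : ℝ) := by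
      simp only [hE, padeErr]; push_cast; ring
    rw [h]
    exact_mod_cast Int.one_le_abs (sub_ne_zero.2 (hne m).symm)
  have hmain := two_sub_le_of_det hqge hqmono hd1 hd2 hprod (by simp) hdet hx hy hm1 hm2
    (by linarith)
  linarith

lemma half_add_le_of_padeErr {k : ℕ} (hk : 2 ≤ k) {ε : ℝ} (hε : 0 < ε) :
    ∃ M, ∀ m ≥ M, ∀ P Q s : ℤ, |(s : ℝ)| = 1 →
      2 * P = padeNum k (m + 2) + s * padeNum k (m + 1) →
      2 * Q = padeDen k (m + 2) + s * padeDen k (m + 1) →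
      |(Q : ℝ)| * |Q * Real.exp (2 / k) - P| ≤ 1 / 2 + ε := by
  obtain ⟨M, hM⟩ := exists_padeDen_mul_padeErr_le hk hε
  refine ⟨M, fun m hm P Q s hs hP hQ => ?_⟩
  have hd1 := hM m hm
  have hd2 := hM (m + 1) (by lia)
  have hdet := padeErr_det k (m + 1)
  have hqge : (1 : ℝ) ≤ padeDen k (m + 1) := by
    exact_mod_cast (padeDen_growth (k := k) (by exact_mod_cast hk) _).1
  have hqmono : (padeDen k (m + 1) : ℝ) ≤ padeDen k (m + 2) := by
    have := padeDen_growth (k := k) (by exact_mod_cast hk) m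
    have : padeDen k (m + 1) ≤ padeDen k (m + 2) := by nlinarith
    exact_mod_cast this
  have hP' := congrArg (Int.cast : ℤ → ℝ) hP
  have hQ' := congrArg (Int.cast : ℤ → ℝ) hQ
  push_cast at hP' hQ'
  have hE : 2 * (Q * Real.exp (2 / k) - P) = padeErr k (m + 2) + s * padeErr k (m + 1) := by
    simp only [padeErr]
    linear_combination Real.exp (2 / k) * hQ' - hP'
  change padeDen k (m + 2) * |padeErr k (m + 2)| ≤ ε at hd2
  change _ * padeErr k (m + 1) - _ * padeErr k (m + 2) = _ at hdet
  change (padeDen k (m + 2) : ℝ) * _ - _ = _ at hdet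
  rw [← abs_mul]
  generalize (Q : ℝ) * Real.exp (2 / k) - P = E at *
  generalize (padeDen k (m + 1) : ℝ) = q at *
  generalize (padeDen k (m + 2) : ℝ) = q' at *
  generalize padeErr k (m + 1) = e at *
  generalize padeErr k (m + 2) = e' at *
  have hs2 : (s : ℝ) ^ 2 = 1 := by rw [← sq_abs, hs]; norm_num
  have hsg : |(-1 : ℝ) ^ (m + 1 + 1)| = 1 := by simp
  generalize (-1 : ℝ) ^ (m + 1 + 1) = w at *
  have hid : 4 * ((Q : ℝ) * E) = q' * e' + q * e + 2 * s * (q * e') + 2 * s * w := by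
    linear_combination 2 * E * hQ' + (q' + s * q) * hE + q * e * hs2 + s * hdet
  have hqe' : q * |e'| ≤ ε := by nlinarith [abs_nonneg e']
  have t1 : |q' * e'| ≤ ε := by rwa [abs_mul, abs_of_pos (by linarith)]
  have t2 : |q * e| ≤ ε := by rwa [abs_mul, abs_of_pos (by linarith)]
  have t3 : |2 * s * (q * e')| ≤ 2 * ε := by
    rw [abs_mul, abs_mul, hs, abs_mul, abs_of_pos (by linarith : 0 < q), abs_two]
    linarith
  have t4 : |2 * s * w| = 2 := by
    rw [abs_mul, abs_mul, hs, hsg]; norm_num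
  have t5 : |4 * ((Q : ℝ) * E)| = 4 * |(Q : ℝ) * E| := by rw [abs_mul]; norm_num
  rw [hid] at t5
  have u1 := abs_add_le (q' * e' + q * e + 2 * s * (q * e')) (2 * s * w)
  have u2 := abs_add_le (q' * e' + q * e) (2 * s * (q * e'))
  have u3 := abs_add_le (q' * e') (q * e)
  linarith

lemma distNearestInt_le (x : ℝ) (p : ℤ) : distNearestInt x ≤ |x - p| := round_le x p

lemma mul_Lconst_eq {θ φ c C : ℝ} (hC : 0 < C)
    (hlow : ∀ ε > 0, ∃ N : ℝ, ∀ q p : ℤ, N ≤ |(q : ℝ)| →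
      c - ε ≤ C * (|(q : ℝ)| * |q * θ - φ - p|))
    (hup : ∀ ε > 0, ∀ N : ℕ, ∃ q p : ℤ, (N : ℤ) ≤ q ∧
      C * (|(q : ℝ)| * |q * θ - φ - p|) ≤ c + ε) :
    C * Lconst θ φ = c := by
  have hfreq : ∀ ε > 0, ∃ᶠ q : ℤ in cofinite,
      |(q : ℝ)| * distNearestInt (q * θ - φ) ≤ (c + ε) / C := by
    intro ε hε
    rw [frequently_cofinite_iff_infinite]
    refine Set.infinite_of_not_bddAbove ?_
    rintro ⟨B, hB⟩
    obtain ⟨q, p, hq, h⟩ := hup ε hε (B + 1).toNat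
    have hmem : q ≤ B := by
      refine hB ?_
      change |(q : ℝ)| * distNearestInt (q * θ - φ) ≤ _
      rw [le_div_iff₀ hC, mul_comm]
      refine le_trans ?_ h
      gcongr
      exact distNearestInt_le _ p
    lia
  have hev : ∀ ε > 0, ∀ᶠ q : ℤ in cofinite,
      (c - ε) / C ≤ |(q : ℝ)| * distNearestInt (q * θ - φ) := by
    intro ε hε
    obtain ⟨N, hN⟩ := hlow ε hε
    have hfin : {q : ℤ | |(q : ℝ)| < N}.Finite := by
      refine (Set.finite_Icc (-⌈N⌉) ⌈N⌉).subset fun q hq => ?_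
      have h1 : |(q : ℝ)| ≤ ⌈N⌉ := (le_of_lt hq).trans (Int.le_ceil N)
      rw [abs_le] at h1
      exact ⟨by exact_mod_cast h1.1, by exact_mod_cast h1.2⟩
    filter_upwards [hfin.compl_mem_cofinite] with q hq
    rw [div_le_iff₀ hC, mul_comm]
    exact hN q _ (not_lt.1 hq)
  have hbdd : IsBoundedUnder (· ≥ ·) cofinite
      fun q : ℤ => |(q : ℝ)| * distNearestInt (q * θ - φ) :=
    isBoundedUnder_of_eventually_ge (hev 1 one_pos)
  have hcobdd : IsCoboundedUnder (· ≥ ·) cofinite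
      fun q : ℤ => |(q : ℝ)| * distNearestInt (q * θ - φ) :=
    IsCoboundedUnder.of_frequently_le (hfreq 1 one_pos)
  refine le_antisymm (le_of_forall_pos_le_add fun ε hε => ?_)
    (le_of_forall_pos_sub_le fun ε hε => ?_)
  · rw [mul_comm, ← le_div_iff₀ hC]
    exact liminf_le_of_frequently_le (hfreq ε hε) hbdd
  · rw [mul_comm, ← div_le_iff₀ hC]
    exact le_liminf_of_le hcobdd (hev ε hε)

lemma padeNum_modEq_one {g k : ℤ} (hg : g ∣ k) (m : ℕ) : padeNum k m ≡ 1 [ZMOD g] := by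
  simpa [padeNum] using padeSeq_modEq_of_dvd hg 1 1 m

lemma padeDen_modEq {g k : ℤ} (hg : g ∣ k) (m : ℕ) :
    padeDen k m ≡ -1 [ZMOD g] ∨ padeDen k m ≡ 1 [ZMOD g] := by
  have h := padeSeq_modEq_of_dvd hg (-1) 1 m
  split_ifs at h
  · exact Or.inl h
  · exact Or.inr h

/-- Infinitely often, half the sum and half the difference of two consecutive rescaled Padé
approximants are congruent modulo `n` to the two standard basis vectors. -/
lemma exists_halves {k : ℕ} (hk : 2 ≤ k) {n : ℕ} (hn : 0 < n) (N : ℕ) :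
    ∃ m, N ≤ m ∧ ∃ a b c d : ℤ,
      2 * (n * a + 1) = padeNum k (m + 2) + padeNum k (m + 1) ∧
      2 * (n * b) = padeDen k (m + 2) + padeDen k (m + 1) ∧
      2 * (n * c) = padeNum k (m + 2) - padeNum k (m + 1) ∧
      2 * (n * d + 1) = padeDen k (m + 2) - padeDen k (m + 1) ∧ (N : ℤ) ≤ b ∧ (N : ℤ) ≤ d := by
  obtain ⟨m, hm, h1, h2, h3, h4⟩ :=
    exists_padeSeq_modEq_initial k (n := 2 * n) (by lia) (2 * n * (N + 1) + 2)
  obtain ⟨m, rfl⟩ : ∃ l, m = l + 1 := ⟨m - 1, by lia⟩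
  obtain ⟨a1, ha1⟩ := h1.symm.dvd
  obtain ⟨a2, ha2⟩ := h2.symm.dvd
  obtain ⟨a3, ha3⟩ := h3.symm.dvd
  obtain ⟨a4, ha4⟩ := h4.symm.dvd
  push_cast at ha1 ha2 ha3 ha4
  obtain ⟨hg1, hg2⟩ := padeDen_growth (k := k) (by exact_mod_cast hk) m
  have hn' : (1 : ℤ) ≤ n := by exact_mod_cast hn
  have hm' : 2 * n * (N + 1) + 1 ≤ m := by lia
  have hm'' : (2 * n * (N + 1) + 1 : ℤ) ≤ m := by exact_mod_cast hm'
  have hbig : (2 * n * (N + 1) + 1 : ℤ) ≤ padeDen k (m + 2) - padeDen k (m + 1) := by nlinarith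
  change padeNum k (m + 2) - 1 = _ at ha2
  change padeDen k (m + 2) - 1 = _ at ha4
  have hb : 2 * (n * (a4 + a3)) = padeDen k (m + 2) + padeDen k (m + 1) := by linarith
  have hd : 2 * (n * (a4 - a3) + 1) = padeDen k (m + 2) - padeDen k (m + 1) := by linarith
  refine ⟨m, by nlinarith, a2 + a1, a4 + a3, a2 - a1, a4 - a3, by linarith, hb, by linarith, hd,
    ?_, ?_⟩
  · by_contra! hlt
    nlinarith
  · by_contra! hlt
    nlinarith

/-- If `k ≥ 1`, `n ≥ 2` and `gcd(n, k) ≠ 1`, then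
`n²·L(e^{2/k}, 1/n) = 1/2` and `n²·L(e^{2/k}, −e^{2/k}/n) = 1/2`. -/
theorem Lconst_exp_eq_half_of_gcd_ne_one (k n : ℕ) (hk : 1 ≤ k) (hn : 2 ≤ n)
    (hgcd : Nat.gcd n k ≠ 1) :
    (n : ℝ) ^ 2 * Lconst (Real.exp (2 / k)) (1 / n) = 1 / 2 ∧
    (n : ℝ) ^ 2 * Lconst (Real.exp (2 / k)) (-(Real.exp (2 / k)) / n) = 1 / 2 := by
  have hk2 : 2 ≤ k := by
    have := Nat.gcd_pos_of_pos_right n hk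
    have := Nat.le_of_dvd hk (Nat.gcd_dvd_right n k)
    lia
  have hgn : (Nat.gcd n k : ℤ) ∣ n := by exact_mod_cast Nat.gcd_dvd_left n k
  have hgk : (Nat.gcd n k : ℤ) ∣ k := by exact_mod_cast Nat.gcd_dvd_right n k
  have hg1 : ¬ (Nat.gcd n k : ℤ) ∣ 1 := fun h => hgcd (by
    have : Nat.gcd n k ∣ 1 := by exact_mod_cast h
    exact Nat.dvd_one.1 this)
  have hn0 : (0 : ℝ) < n := by positivity
  have hn1 : (1 : ℝ) ≤ n := by exact_mod_cast (by lia : 1 ≤ n)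
  constructor
  · refine mul_Lconst_eq (by positivity) (fun ε hε => ?_) (fun ε hε N => ?_)
    · obtain ⟨N, hN⟩ := half_sub_le_abs_mul_abs hk2 hε
      refine ⟨max N 0, fun q p hq => ?_⟩
      have h := hN (n * p + 1) (n * q) ?_ fun m hm => hg1 ?_
      · refine h.trans_eq ?_
        push_cast
        rw [show (n : ℝ) * q * Real.exp (2 / k) - (n * p + 1)
          = n * (q * Real.exp (2 / k) - 1 / n - p) by field_simp; ring, abs_mul, abs_mul,
          abs_of_pos hn0]
        ring
      · push_cast
        rw [abs_mul, abs_of_pos hn0]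
        have := (le_max_left N 0).trans hq
        nlinarith [abs_nonneg (q : ℝ)]
      · have hdvd : (Nat.gcd n k : ℤ) ∣ padeDen k (m + 1) := by
          have : padeDen k (m + 1) = n * (q * padeNum k (m + 1) - p * padeDen k (m + 1)) := by
            linear_combination hm
          rw [this]
          exact hgn.mul_right _
        rcases padeDen_modEq hgk (m + 1) with h | h
        · exact dvd_neg.1 (h.dvd_iff.1 hdvd)
        · exact h.dvd_iff.1 hdvd
    · obtain ⟨M, hM⟩ := half_add_le_of_padeErr hk2 hε
      obtain ⟨m, hm, a, b, c, d, ha, hb, -, -, hNb, -⟩ :=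
        exists_halves hk2 (by lia : 0 < n) (max M N)
      have h := hM m (by lia) (n * a + 1) (n * b) 1 (by simp) (by rw [ha]; ring)
        (by rw [hb]; ring)
      refine ⟨b, a, by lia, le_of_eq_of_le ?_ h⟩
      push_cast
      rw [show (n : ℝ) * b * Real.exp (2 / k) - (n * a + 1)
        = n * (b * Real.exp (2 / k) - 1 / n - a) by field_simp; ring, abs_mul, abs_mul,
        abs_of_pos hn0]
      ring
  · have hscale : ∀ q p : ℤ, (n : ℝ) ^ 2 *
        (|(q : ℝ)| * |q * Real.exp (2 / k) - -Real.exp (2 / k) / n - p|)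
        = n * |(q : ℝ)| * |((n * q + 1 : ℤ) : ℝ) * Real.exp (2 / k) - (n * p : ℤ)| := by
      intro q p
      push_cast
      rw [show ((n : ℝ) * q + 1) * Real.exp (2 / k) - n * p
        = n * (q * Real.exp (2 / k) - -Real.exp (2 / k) / n - p) by field_simp; ring, abs_mul,
        abs_of_pos hn0]
      ring
    refine mul_Lconst_eq (by positivity) (fun ε hε => ?_) (fun ε hε N => ?_)
    · obtain ⟨N, hN⟩ := half_sub_le_abs_mul_abs hk2 (half_pos hε)
      refine ⟨max (N + 1) (max 1 (1 / ε)), fun q p hq => ?_⟩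
      have hqN := (le_max_left _ _).trans hq
      have hq1 := ((le_max_left _ _).trans (le_max_right _ _)).trans hq
      have hqε := ((le_max_right _ _).trans (le_max_right _ _)).trans hq
      have habs : |((n * q + 1 : ℤ) : ℝ)| ≤ n * |(q : ℝ)| + 1 := by
        push_cast
        refine (abs_add_le _ _).trans_eq ?_
        rw [abs_mul, abs_of_pos hn0, abs_one]
      have h := hN (n * p) (n * q + 1) ?_ fun m hm => hg1 ?_
      · rw [hscale]
        have hE0 := abs_nonneg (((n * q + 1 : ℤ) : ℝ) * Real.exp (2 / k) - (n * p : ℤ))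
        generalize |((n * q + 1 : ℤ) : ℝ) * Real.exp (2 / k) - (n * p : ℤ)| = E at *
        rw [div_le_iff₀ hε] at hqε
        have hnq : |(q : ℝ)| ≤ n * |(q : ℝ)| := by nlinarith
        rcases le_or_gt E (ε / 2) with hE | hE
        · nlinarith
        · nlinarith
      · push_cast
        have h1 : |(n : ℝ) * q| ≤ |(n : ℝ) * q + 1| + 1 := by
          have := abs_sub ((n : ℝ) * q + 1) 1
          rwa [add_sub_cancel_right, abs_one] at this
        rw [abs_mul, abs_of_pos hn0] at h1
        nlinarith
      · have hdvd : (Nat.gcd n k : ℤ) ∣ padeNum k (m + 1) := by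
          have : padeNum k (m + 1) = n * (p * padeDen k (m + 1) - q * padeNum k (m + 1)) := by
            linear_combination -hm
          rw [this]
          exact hgn.mul_right _
        exact (padeNum_modEq_one hgk (m + 1)).dvd_iff.1 hdvd
    · obtain ⟨M, hM⟩ := half_add_le_of_padeErr hk2 hε
      obtain ⟨m, hm, a, b, c, d, -, -, hc, hd, -, hNd⟩ :=
        exists_halves hk2 (by lia : 0 < n) (max M N)
      have h := hM m (by lia) (n * c) (n * d + 1) (-1) (by simp) (by rw [hc]; ring)
        (by rw [hd]; ring)
      refine ⟨d, c, by lia, le_trans ?_ h⟩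
      rw [hscale]
      gcongr
      have hd0 : (0 : ℝ) ≤ d := by exact_mod_cast (by lia : 0 ≤ d)
      push_cast
      rw [abs_of_nonneg hd0, abs_of_nonneg (by positivity)]
      linarith
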